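/- arXiv:2006.04349 — 2 statements merged into one kernel-verified Lean document; each statement's English description precedes it below -/
import Mathlib

section
/- Let f : ℝ → ℝ be a convex lower semicontinuous function with f(1) = 0, let f⋆(y) = sup_{x∈ℝ} (x·y − f(x)) be its convex conjugate, let 𝓕 ⊆ F(Ω,ℝ), and let 𝓗 ⊆ F(Ω,ℝ) be a set of functions taking values in the domain of f⋆ such that f⋆∘h is bounded and measurable for every h ∈ 𝓗. Then for all Borel probability measures μ, P on Ω and all ε > 0, sup_{Q ∈ B_{ε,𝓕}(P)} GAN_{f,𝓗}(μ; Q) ≤ GAN_{f,𝓗}(μ; P) + ε · sup_{h ∈ 𝓗} Θ_𝓕(h). -/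
open MeasureTheory Set Pointwise
open scoped ENNReal NNReal

noncomputable section

/-- `F(Ω,ℝ)`: the set of bounded measurable functions `Ω → ℝ`. -/
def Fbm (Ω : Type*) [MeasurableSpace Ω] : Set (Ω → ℝ) :=
  {h | Measurable h ∧ ∃ C : ℝ, ∀ ω, |h ω| ≤ C}

/-- Closed convex hull of a set of functions with respect to the topology of
uniform convergence. -/
def cchull {Ω : Type*} (𝓕 : Set (Ω → ℝ)) : Set (Ω → ℝ) :=
  {h | ∀ δ : ℝ, 0 < δ → ∃ g ∈ convexHull ℝ 𝓕, ∀ ω, |h ω - g ω| ≤ δ}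

/-- `Θ_𝓕(h) = inf {λ > 0 : h ∈ λ · cl (co 𝓕)}`, valued in `[0,∞]` (inf over the
empty set is `⊤`). -/
def theta {Ω : Type*} (𝓕 : Set (Ω → ℝ)) (h : Ω → ℝ) : EReal :=
  sInf ((fun l : ℝ => (l : EReal)) '' {l : ℝ | 0 < l ∧ h ∈ l • cchull 𝓕})

/-- The Integral Probability Metric `d_𝓕(P,Q) = sup_{g ∈ 𝓕} (∫ g dP - ∫ g dQ)`. -/
def ipm {Ω : Type*} [MeasurableSpace Ω] (𝓕 : Set (Ω → ℝ)) (P Q : Measure Ω) : EReal :=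
  ⨆ g ∈ 𝓕, ((∫ ω, g ω ∂P - ∫ ω, g ω ∂Q : ℝ) : EReal)

/-- The uncertainty ball `B_{ε,𝓕}(P) = {Q probability measure : d_𝓕(Q,P) ≤ ε}`. -/
def uball {Ω : Type*} [MeasurableSpace Ω] (𝓕 : Set (Ω → ℝ)) (ε : ℝ) (P : Measure Ω) :
    Set (Measure Ω) :=
  {Q | IsProbabilityMeasure Q ∧ ipm 𝓕 Q P ≤ (ε : EReal)}

/-- `J_P(h) = sup_{ν probability measure} ∫ h dν - ∫ h dP`. -/
def Jpen {Ω : Type*} [MeasurableSpace Ω] (P : Measure Ω) (h : Ω → ℝ) : EReal :=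
  (⨆ ν : Measure Ω, ⨆ _ : IsProbabilityMeasure ν, ((∫ ω, h ω ∂ν : ℝ) : EReal))
    - ((∫ ω, h ω ∂P : ℝ) : EReal)

/-- The `𝓕`-penalty `Λ_{𝓕,ε} = J_P □ (ε·Θ_𝓕)` (infimal convolution over `F(Ω,ℝ)`). -/
def Lam {Ω : Type*} [MeasurableSpace Ω] (𝓕 : Set (Ω → ℝ)) (P : Measure Ω) (ε : ℝ)
    (h : Ω → ℝ) : EReal :=
  ⨅ h' ∈ Fbm Ω, (Jpen P h' + (ε : EReal) * theta 𝓕 (h - h'))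

/-- Convex conjugate `f⋆(y) = sup_x (x·y − f(x))` (as a junk-valued real sup; the
hypotheses below require `BddAbove` wherever it is used). -/
def fstar (f : ℝ → ℝ) (y : ℝ) : ℝ := ⨆ x : ℝ, (x * y - f x)

/-- The `f`-GAN objective `GAN_{f,𝓗}(μ; P) = sup_{h ∈ 𝓗} (∫ h dP − ∫ f⋆(h) dμ)`. -/
def gan {Ω : Type*} [MeasurableSpace Ω] (f : ℝ → ℝ) (𝓗 : Set (Ω → ℝ)) (μ P : Measure Ω) :
    EReal :=
  ⨆ h ∈ 𝓗, ((∫ ω, h ω ∂P - ∫ ω, fstar f (h ω) ∂μ : ℝ) : EReal)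

theorem Fbm.integrable {Ω : Type*} [MeasurableSpace Ω] {h : Ω → ℝ} (hh : h ∈ Fbm Ω)
    (P : Measure Ω) [IsFiniteMeasure P] : Integrable h P := by
  obtain ⟨hm, C, hC⟩ := hh
  exact Integrable.of_bound hm.aestronglyMeasurable C (Filter.Eventually.of_forall hC)

theorem convexHull_subset_integral_sub_le {Ω : Type*} [MeasurableSpace Ω] {𝓕 : Set (Ω → ℝ)}
    (h𝓕 : 𝓕 ⊆ Fbm Ω) {P Q : Measure Ω} [IsFiniteMeasure P] [IsFiniteMeasure Q] {ε : ℝ}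
    (hQ : ipm 𝓕 Q P ≤ ε) :
    convexHull ℝ 𝓕 ⊆
      {g | Integrable g Q ∧ Integrable g P ∧ ∫ ω, g ω ∂Q - ∫ ω, g ω ∂P ≤ ε} := by
  refine convexHull_min (fun g hg => ?_) ?_
  · refine ⟨Fbm.integrable (h𝓕 hg) Q, Fbm.integrable (h𝓕 hg) P, ?_⟩
    exact EReal.coe_le_coe_iff.1 ((le_iSup₂_of_le g hg le_rfl).trans hQ)
  · rintro g ⟨hgQ, hgP, hg⟩ k ⟨hkQ, hkP, hk⟩ a b ha hb hab
    refine ⟨(hgQ.smul a).add (hkQ.smul b), (hgP.smul a).add (hkP.smul b), ?_⟩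
    simp only [Pi.add_apply, Pi.smul_apply, smul_eq_mul]
    rw [integral_add (hgQ.const_mul a) (hkQ.const_mul b),
      integral_add (hgP.const_mul a) (hkP.const_mul b)]
    simp only [integral_const_mul]
    have h₁ := mul_le_mul_of_nonneg_left hg ha
    have h₂ := mul_le_mul_of_nonneg_left hk hb
    have h₃ : a * ε + b * ε = ε := by rw [← add_mul, hab, one_mul]
    linarith

theorem abs_integral_sub_le_of_uniform {Ω : Type*} [MeasurableSpace Ω] {P : Measure Ω}
    [IsProbabilityMeasure P] {g k : Ω → ℝ} (hg : Integrable g P) (hk : Integrable k P) {δ : ℝ}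
    (h : ∀ ω, |k ω - g ω| ≤ δ) : |∫ ω, k ω ∂P - ∫ ω, g ω ∂P| ≤ δ := by
  rw [← integral_sub hk hg]
  simpa using norm_integral_le_of_norm_le_const (μ := P) (f := fun ω => k ω - g ω)
    (Filter.Eventually.of_forall h)

theorem integral_sub_le_of_mem_cchull {Ω : Type*} [MeasurableSpace Ω] {𝓕 : Set (Ω → ℝ)}
    (h𝓕 : 𝓕 ⊆ Fbm Ω) {P Q : Measure Ω} [IsProbabilityMeasure P] [IsProbabilityMeasure Q]
    {ε : ℝ} (hQ : ipm 𝓕 Q P ≤ ε) {k : Ω → ℝ} (hkQ : Integrable k Q) (hkP : Integrable k P)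
    (hk : k ∈ cchull 𝓕) : ∫ ω, k ω ∂Q - ∫ ω, k ω ∂P ≤ ε := by
  refine le_of_forall_pos_le_add fun δ hδ => ?_
  obtain ⟨g, hg, hkg⟩ := hk (δ / 2) (half_pos hδ)
  obtain ⟨hgQ, hgP, hgε⟩ := convexHull_subset_integral_sub_le h𝓕 hQ hg
  have h₁ := (abs_le.1 (abs_integral_sub_le_of_uniform hgQ hkQ hkg)).2
  have h₂ := (abs_le.1 (abs_integral_sub_le_of_uniform hgP hkP hkg)).1
  linarith

theorem integral_sub_le_mul_theta {Ω : Type*} [MeasurableSpace Ω] {𝓕 : Set (Ω → ℝ)}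
    (h𝓕 : 𝓕 ⊆ Fbm Ω) {P Q : Measure Ω} [IsProbabilityMeasure P] [IsProbabilityMeasure Q]
    {ε : ℝ} (hε : 0 < ε) (hQ : ipm 𝓕 Q P ≤ ε) {h : Ω → ℝ} (hhQ : Integrable h Q)
    (hhP : Integrable h P) :
    ((∫ ω, h ω ∂Q - ∫ ω, h ω ∂P : ℝ) : EReal) ≤ ε * theta 𝓕 h := by
  have key : (((∫ ω, h ω ∂Q - ∫ ω, h ω ∂P) / ε : ℝ) : EReal) ≤ theta 𝓕 h := by
    refine le_sInf ?_
    rintro _ ⟨l, ⟨hl, k, hk, rfl⟩, rfl⟩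
    have hkQ : Integrable k Q := (integrable_smul_iff hl.ne' k).1 hhQ
    have hkP : Integrable k P := (integrable_smul_iff hl.ne' k).1 hhP
    have hle := integral_sub_le_of_mem_cchull h𝓕 hQ hkQ hkP hk
    rw [EReal.coe_le_coe_iff, div_le_iff₀ hε]
    simp only [Pi.smul_apply, smul_eq_mul, integral_const_mul, ← mul_sub]
    exact mul_le_mul_of_nonneg_left hle hl.le
  calc ((∫ ω, h ω ∂Q - ∫ ω, h ω ∂P : ℝ) : EReal)
      = (ε : EReal) * (((∫ ω, h ω ∂Q - ∫ ω, h ω ∂P) / ε : ℝ) : EReal) := by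
        rw [← EReal.coe_mul, mul_div_cancel₀ _ hε.ne']
    _ ≤ ε * theta 𝓕 h := mul_le_mul_of_nonneg_left key (EReal.coe_nonneg.2 hε.le)

theorem stmt6 {Ω : Type*} [TopologicalSpace Ω] [PolishSpace Ω] [MeasurableSpace Ω] [BorelSpace Ω]
    (f : ℝ → ℝ) (hconv : ConvexOn ℝ Set.univ f) (hlsc : LowerSemicontinuous f) (hf1 : f 1 = 0)
    (𝓕 : Set (Ω → ℝ)) (h𝓕 : 𝓕 ⊆ Fbm Ω) (𝓗 : Set (Ω → ℝ)) (h𝓗 : 𝓗 ⊆ Fbm Ω)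
    (hdom : ∀ h ∈ 𝓗, ∀ ω, BddAbove (Set.range fun x : ℝ => x * h ω - f x))
    (hfb : ∀ h ∈ 𝓗, (fun ω => fstar f (h ω)) ∈ Fbm Ω)
    (μ P : Measure Ω) [IsProbabilityMeasure μ] [IsProbabilityMeasure P]
    (ε : ℝ) (hε : 0 < ε) :
    (⨆ Q ∈ uball 𝓕 ε P, gan f 𝓗 μ Q)
      ≤ gan f 𝓗 μ P + (ε : EReal) * ⨆ h ∈ 𝓗, theta 𝓕 h := by
  refine iSup₂_le fun Q hQ => iSup₂_le fun h hh => ?_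
  obtain ⟨hQprob, hQ⟩ := hQ
  have hθ : ((∫ ω, h ω ∂Q - ∫ ω, h ω ∂P : ℝ) : EReal) ≤ ε * ⨆ h ∈ 𝓗, theta 𝓕 h :=
    (integral_sub_le_mul_theta h𝓕 hε hQ (Fbm.integrable (h𝓗 hh) Q)
      (Fbm.integrable (h𝓗 hh) P)).trans
      (mul_le_mul_of_nonneg_left (le_iSup₂_of_le h hh le_rfl) (EReal.coe_nonneg.2 hε.le))
  have hP : ((∫ ω, h ω ∂P - ∫ ω, fstar f (h ω) ∂μ : ℝ) : EReal) ≤ gan f 𝓗 μ P :=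
    le_iSup₂_of_le h hh le_rfl
  refine le_trans (le_of_eq ?_) (add_le_add hP hθ)
  rw [← EReal.coe_add]
  congr 1
  ring
end
end

section
/- Let Ω be a Polish space, μ a Borel probability measure on Ω, and 𝓕 = {h ∈ F(Ω,ℝ) : E_μ[h²] ≤ 1} the μ-Fisher IPM generating set. Then Θ_𝓕(h) = √(E_μ[h²]) and inf_{b ∈ ℝ} Θ_𝓕(h − b) = √(Var_μ(h)) for every h ∈ F(Ω,ℝ); consequently, for every Borel probability measure P on Ω and every ε > 0, sup_{Q ∈ B_{ε,𝓕}(P)} ∫_Ω h dQ ≤ ∫_Ω h dP + ε·√(Var_μ(h)). -/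
open MeasureTheory Set Pointwise
open scoped ENNReal NNReal

noncomputable section

/-- The sup norm `‖g‖_∞ = sup_ω |g(ω)|` (as a real supremum; honest on bounded
functions). -/
def supnorm {Ω : Type*} (g : Ω → ℝ) : ℝ := ⨆ ω, |g ω|

lemma integrable_of_mem_Fbm {Ω : Type*} [MeasurableSpace Ω] {g : Ω → ℝ} (hg : g ∈ Fbm Ω)
    (μ : Measure Ω) [IsFiniteMeasure μ] : Integrable g μ := by
  obtain ⟨hm, C, hC⟩ := hg
  exact Integrable.of_bound hm.aestronglyMeasurable C (Filter.Eventually.of_forall hC)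

lemma integrable_sq_of_mem_Fbm {Ω : Type*} [MeasurableSpace Ω] {g : Ω → ℝ} (hg : g ∈ Fbm Ω)
    (μ : Measure Ω) [IsFiniteMeasure μ] : Integrable (fun ω => (g ω) ^ 2) μ := by
  obtain ⟨hm, C, hC⟩ := hg
  refine Integrable.of_bound (hm.pow_const 2).aestronglyMeasurable (C ^ 2)
    (Filter.Eventually.of_forall fun ω => ?_)
  rw [Real.norm_eq_abs, abs_pow]
  exact pow_le_pow_left₀ (abs_nonneg _) (hC ω) 2

lemma smul_mem_Fbm {Ω : Type*} [MeasurableSpace Ω] {g : Ω → ℝ} (hg : g ∈ Fbm Ω) (c : ℝ) :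
    c • g ∈ Fbm Ω := by
  obtain ⟨hm, C, hC⟩ := hg
  refine ⟨hm.const_smul c, |c| * C, fun ω => ?_⟩
  simpa [abs_mul] using mul_le_mul_of_nonneg_left (hC ω) (abs_nonneg c)

lemma add_mem_Fbm {Ω : Type*} [MeasurableSpace Ω] {f g : Ω → ℝ} (hf : f ∈ Fbm Ω) (hg : g ∈ Fbm Ω) :
    f + g ∈ Fbm Ω := by
  obtain ⟨hfm, C, hC⟩ := hf
  obtain ⟨hgm, D, hD⟩ := hg
  exact ⟨hfm.add hgm, C + D, fun ω => (abs_add_le _ _).trans (add_le_add (hC ω) (hD ω))⟩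

lemma sub_const_mem_Fbm {Ω : Type*} [MeasurableSpace Ω] {g : Ω → ℝ} (hg : g ∈ Fbm Ω) (b : ℝ) :
    (fun ω => g ω - b) ∈ Fbm Ω := by
  obtain ⟨hm, C, hC⟩ := hg
  exact ⟨hm.sub_const b, C + |b|, fun ω => (abs_sub _ _).trans (add_le_add_left (hC ω) _)⟩

/-- The generating set of the `μ`-Fisher integral probability metric. -/
abbrev fisherSet {Ω : Type*} [MeasurableSpace Ω] (μ : Measure Ω) : Set (Ω → ℝ) :=
  {g : Ω → ℝ | g ∈ Fbm Ω ∧ ∫ ω, (g ω) ^ 2 ∂μ ≤ 1}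

lemma convex_fisherSet {Ω : Type*} [MeasurableSpace Ω] (μ : Measure Ω) [IsFiniteMeasure μ] :
    Convex ℝ (fisherSet μ) := by
  rintro f ⟨hf, hf1⟩ g ⟨hg, hg1⟩ a b ha hb hab
  have hfg : a • f + b • g ∈ Fbm Ω := add_mem_Fbm (smul_mem_Fbm hf a) (smul_mem_Fbm hg b)
  refine ⟨hfg, ?_⟩
  have hf2 := (integrable_sq_of_mem_Fbm hf μ).const_mul a
  have hg2 := (integrable_sq_of_mem_Fbm hg μ).const_mul b
  have hle : ∫ ω, ((a • f + b • g) ω) ^ 2 ∂μ ≤ ∫ ω, (a * f ω ^ 2 + b * g ω ^ 2) ∂μ := by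
    refine integral_mono (integrable_sq_of_mem_Fbm hfg μ)
      (hf2.add hg2) fun ω => ?_
    obtain rfl : b = 1 - a := by linarith
    simp only [Pi.add_apply, Pi.smul_apply, smul_eq_mul]
    nlinarith [mul_nonneg (mul_nonneg ha hb) (sq_nonneg (f ω - g ω))]
  rw [integral_add hf2 hg2, integral_const_mul, integral_const_mul] at hle
  nlinarith

lemma integral_sq_le_one_of_mem_cchull {Ω : Type*} [MeasurableSpace Ω] (μ : Measure Ω)
    [IsProbabilityMeasure μ] {g : Ω → ℝ} (hg : g ∈ Fbm Ω) (hgc : g ∈ cchull (fisherSet μ)) :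
    ∫ ω, (g ω) ^ 2 ∂μ ≤ 1 := by
  have key : ∀ δ : ℝ, 0 < δ → δ ≤ 1 → ∫ ω, (g ω) ^ 2 ∂μ ≤ 1 + 3 * δ := by
    intro δ hδ hδ1
    obtain ⟨f, hf, hfg⟩ := hgc δ hδ
    rw [(convex_fisherSet μ).convexHull_eq] at hf
    obtain ⟨hf, hf1⟩ := hf
    have hle : ∫ ω, (g ω) ^ 2 ∂μ ≤ ∫ ω, ((1 + δ) * f ω ^ 2 + (δ + δ ^ 2)) ∂μ := by
      refine integral_mono (integrable_sq_of_mem_Fbm hg μ)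
        (((integrable_sq_of_mem_Fbm hf μ).const_mul _).add (integrable_const _)) fun ω => ?_
      have hd := sq_le_sq' (neg_le_of_abs_le (hfg ω)) (le_of_abs_le (hfg ω))
      have hyoung : 2 * f ω * (g ω - f ω) ≤ δ * f ω ^ 2 + δ := by
        have h1 : 2 * f ω * (g ω - f ω) ≤ 2 * |f ω| * δ :=
          (le_abs_self _).trans (by
            rw [abs_mul, abs_mul, abs_two]
            exact mul_le_mul_of_nonneg_left (hfg ω) (by positivity))
        nlinarith [mul_nonneg hδ.le (sq_nonneg (|f ω| - 1)), sq_abs (f ω)]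
      simp only
      nlinarith
    rw [integral_add ((integrable_sq_of_mem_Fbm hf μ).const_mul _) (integrable_const _),
      integral_const_mul] at hle
    simp only [integral_const, probReal_univ, smul_eq_mul, one_mul] at hle
    nlinarith
  by_contra! hlt
  have h1 := key (min 1 ((∫ ω, (g ω) ^ 2 ∂μ - 1) / 6))
    (lt_min one_pos (by linarith)) (min_le_left _ _)
  have h2 := min_le_right 1 ((∫ ω, (g ω) ^ 2 ∂μ - 1) / 6)
  linarith

lemma inv_smul_mem_fisherSet {Ω : Type*} [MeasurableSpace Ω] (μ : Measure Ω) {g : Ω → ℝ}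
    (hg : g ∈ Fbm Ω) {l : ℝ} (hl : 0 < l) (hle : √(∫ ω, (g ω) ^ 2 ∂μ) ≤ l) :
    l⁻¹ • g ∈ fisherSet μ := by
  refine ⟨smul_mem_Fbm hg _, ?_⟩
  simp only [Pi.smul_apply, smul_eq_mul, mul_pow]
  rw [integral_const_mul, inv_pow, inv_mul_le_iff₀ (by positivity), mul_one]
  exact (Real.sqrt_le_left hl.le).1 hle

lemma subset_cchull {Ω : Type*} (𝓕 : Set (Ω → ℝ)) : 𝓕 ⊆ cchull 𝓕 :=
  fun g hg _ hδ => ⟨g, subset_convexHull ℝ 𝓕 hg, fun _ => by simpa using hδ.le⟩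

lemma theta_fisherSet {Ω : Type*} [MeasurableSpace Ω] (μ : Measure Ω) [IsProbabilityMeasure μ]
    {h : Ω → ℝ} (hh : h ∈ Fbm Ω) :
    theta (fisherSet μ) h = ((√(∫ ω, (h ω) ^ 2 ∂μ) : ℝ) : EReal) := by
  refine le_antisymm ?_ ?_
  · refine EReal.le_of_forall_lt_iff_le.1 fun l hl => sInf_le ⟨l, ?_, rfl⟩
    have hl' : √(∫ ω, (h ω) ^ 2 ∂μ) < l := EReal.coe_lt_coe_iff.1 hl
    have hpos : 0 < l := (Real.sqrt_nonneg _).trans_lt hl'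
    exact ⟨hpos, l⁻¹ • h, subset_cchull _ (inv_smul_mem_fisherSet μ hh hpos hl'.le),
      smul_inv_smul₀ hpos.ne' h⟩
  · refine le_sInf ?_
    rintro _ ⟨l, ⟨hl, g, hgc, rfl⟩, rfl⟩
    have hg : g ∈ Fbm Ω := by simpa [inv_smul_smul₀ hl.ne'] using smul_mem_Fbm hh l⁻¹
    refine EReal.coe_le_coe_iff.2 ((Real.sqrt_le_left hl.le).2 ?_)
    simp only [Pi.smul_apply, smul_eq_mul, mul_pow]
    rw [integral_const_mul]
    exact mul_le_of_le_one_right (sq_nonneg l) (integral_sq_le_one_of_mem_cchull μ hg hgc)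

lemma integral_sub_const_sq {Ω : Type*} [MeasurableSpace Ω] (μ : Measure Ω)
    [IsProbabilityMeasure μ] {h : Ω → ℝ} (hh : h ∈ Fbm Ω) (b : ℝ) :
    ∫ ω, (h ω - b) ^ 2 ∂μ
      = (∫ ω, (h ω) ^ 2 ∂μ) - (∫ ω, h ω ∂μ) ^ 2 + (∫ ω, h ω ∂μ - b) ^ 2 := by
  have hexp : ∀ ω, (h ω - b) ^ 2 = h ω ^ 2 - 2 * b * h ω + b ^ 2 := fun ω => by ring
  simp only [hexp]
  have hsq := integrable_sq_of_mem_Fbm hh μ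
  have hlin : Integrable (fun ω => 2 * b * h ω) μ := (integrable_of_mem_Fbm hh μ).const_mul _
  have hdiff : Integrable (fun ω => h ω ^ 2 - 2 * b * h ω) μ := hsq.sub hlin
  rw [integral_add hdiff (integrable_const _), integral_sub hsq hlin, integral_const_mul]
  simp only [integral_const, probReal_univ, smul_eq_mul, one_mul]
  ring

lemma integral_sub_le_of_mem_uball {Ω : Type*} [MeasurableSpace Ω] (μ : Measure Ω)
    {h : Ω → ℝ} (hh : h ∈ Fbm Ω) {P Q : Measure Ω} [IsProbabilityMeasure P] {ε : ℝ} (hε : 0 < ε)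
    (hQ : Q ∈ uball (fisherSet μ) ε P) (b : ℝ) :
    ∫ ω, h ω ∂Q - ∫ ω, h ω ∂P ≤ ε * √(∫ ω, (h ω - b) ^ 2 ∂μ) := by
  obtain ⟨_, hQ⟩ := hQ
  have key : ∀ l, √(∫ ω, (h ω - b) ^ 2 ∂μ) < l → (∫ ω, h ω ∂Q - ∫ ω, h ω ∂P) / ε ≤ l := by
    intro l hl
    have hpos : 0 < l := (Real.sqrt_nonneg _).trans_lt hl
    have hg := inv_smul_mem_fisherSet μ (sub_const_mem_Fbm hh b) hpos hl.le
    have hle := EReal.coe_le_coe_iff.1 ((le_iSup₂ (f := fun (g : Ω → ℝ) (_ : g ∈ fisherSet μ) =>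
      ((∫ ω, g ω ∂Q - ∫ ω, g ω ∂P : ℝ) : EReal)) _ hg).trans hQ)
    simp only [Pi.smul_apply, smul_eq_mul] at hle
    rw [integral_const_mul, integral_const_mul,
      integral_sub (integrable_of_mem_Fbm hh Q) (integrable_const _),
      integral_sub (integrable_of_mem_Fbm hh P) (integrable_const _), ← mul_sub,
      inv_mul_le_iff₀ hpos] at hle
    simp only [integral_const, probReal_univ, smul_eq_mul, one_mul] at hle
    rw [div_le_iff₀ hε]
    linarith
  have := le_of_forall_gt_imp_ge_of_dense key
  rwa [div_le_iff₀' hε] at this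

theorem stmt19 {Ω : Type*} [TopologicalSpace Ω] [PolishSpace Ω] [MeasurableSpace Ω] [BorelSpace Ω]
    (μ : Measure Ω) [IsProbabilityMeasure μ] (h : Ω → ℝ) (hh : h ∈ Fbm Ω) :
    (theta {g : Ω → ℝ | g ∈ Fbm Ω ∧ ∫ ω, (g ω) ^ 2 ∂μ ≤ 1} h
        = ((Real.sqrt (∫ ω, (h ω) ^ 2 ∂μ) : ℝ) : EReal)) ∧
    ((⨅ b : ℝ, theta {g : Ω → ℝ | g ∈ Fbm Ω ∧ ∫ ω, (g ω) ^ 2 ∂μ ≤ 1} (fun ω => h ω - b))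
        = ((Real.sqrt ((∫ ω, (h ω) ^ 2 ∂μ) - (∫ ω, h ω ∂μ) ^ 2) : ℝ) : EReal)) ∧
    (∀ P : Measure Ω, IsProbabilityMeasure P → ∀ ε : ℝ, 0 < ε →
        (⨆ Q ∈ uball {g : Ω → ℝ | g ∈ Fbm Ω ∧ ∫ ω, (g ω) ^ 2 ∂μ ≤ 1} ε P,
            ((∫ ω, h ω ∂Q : ℝ) : EReal))
          ≤ ((∫ ω, h ω ∂P : ℝ) : EReal)
            + (ε : EReal) * ((Real.sqrt ((∫ ω, (h ω) ^ 2 ∂μ) - (∫ ω, h ω ∂μ) ^ 2) : ℝ) : EReal)) := by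
  refine ⟨theta_fisherSet μ hh, ?_, fun P hP ε hε => iSup₂_le fun Q hQ => ?_⟩
  · simp only [fun b : ℝ => theta_fisherSet μ (sub_const_mem_Fbm hh b), integral_sub_const_sq μ hh]
    refine le_antisymm (iInf_le_of_le (∫ ω, h ω ∂μ) (by simp)) (le_iInf fun b => ?_)
    exact EReal.coe_le_coe_iff.2 (Real.sqrt_le_sqrt (le_add_of_nonneg_right (sq_nonneg _)))
  · have hle := integral_sub_le_of_mem_uball μ hh hε hQ (∫ ω, h ω ∂μ)
    rw [integral_sub_const_sq μ hh, sub_self, zero_pow two_ne_zero, add_zero] at hle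
    exact_mod_cast sub_le_iff_le_add'.1 hle
end
end
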